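/- Let α, β ∈ ℤ_{≥0}^n with [x^β]κ_α > 0. Then β ≥_dom α, i.e., β_1 + ⋯ + β_t ≥ α_1 + ⋯ + α_t for every 1 ≤ t ≤ n (note |β| = |α|). -/

import Mathlib

open scoped Classical

namespace LSS

noncomputable section

open MvPolynomial

/-- The simple transposition `s_i ∈ S_n` (`1 ≤ i ≤ n-1`, 1-indexed): it exchanges the
letters `i` and `i+1` of `[n] = {1, …, n}`, realized on `Fin n` (0-indexed) as the swap
of `i-1` and `i`. For `i` out of range it is the identity. -/
def st (n : ℕ) (i : ℕ) : Equiv.Perm (Fin n) :=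
  if h : 0 < i ∧ i < n then Equiv.swap ⟨i - 1, by omega⟩ ⟨i, h.2⟩ else 1

/-- Coxeter length of `w ∈ S_n` = number of inversions. -/
def len (n : ℕ) (w : Equiv.Perm (Fin n)) : ℕ :=
  (Finset.univ.filter fun p : Fin n × Fin n => p.1 < p.2 ∧ w p.2 < w p.1).card

/-- `L` is a reduced word for `w`: a list of indices in `[n-1]` of length `ℓ(w)` whose
associated product of simple transpositions is `w`. -/
def IsRedWord (n : ℕ) (L : List ℕ) (w : Equiv.Perm (Fin n)) : Prop :=
  (∀ i ∈ L, 1 ≤ i ∧ i ≤ n - 1) ∧ (L.map (st n)).prod = w ∧ L.length = len n w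

/-- The left descent set `J(w) = {j ∈ [n-1] : ℓ(s_j w) < ℓ(w)}`. -/
def Descents (n : ℕ) (w : Equiv.Perm (Fin n)) : Set ℕ :=
  {j | 1 ≤ j ∧ j ≤ n - 1 ∧ len n (st n j * w) < len n w}

/-- The parabolic subgroup of `S_n` generated by `{s_i : i ∈ I}`. -/
def parab (n : ℕ) (I : Set ℕ) : Subgroup (Equiv.Perm (Fin n)) :=
  Subgroup.closure (st n '' I)

/-- `u = w_0(I)`, the longest element of the parabolic subgroup generated by `{s_i : i ∈ I}`. -/
def IsLongest (n : ℕ) (I : Set ℕ) (u : Equiv.Perm (Fin n)) : Prop :=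
  u ∈ parab n I ∧ ∀ v ∈ parab n I, len n v ≤ len n u

/-- `c` is a standard Coxeter element of some parabolic subgroup of `S_n`: a product of
the elements of some subset of `{s_1, …, s_{n-1}}`, each appearing exactly once, in some order. -/
def IsStdCox (n : ℕ) (c : Equiv.Perm (Fin n)) : Prop :=
  ∃ L : List ℕ, L.Nodup ∧ (∀ i ∈ L, 1 ≤ i ∧ i ≤ n - 1) ∧ (L.map (st n)).prod = c

/-- A weak composition `β : Fin n → ℕ` as an exponent vector. -/
def expOf (n : ℕ) (β : Fin n → ℕ) : Fin n →₀ ℕ := Finsupp.equivFunOnFinite.symm β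

/-- The monomial `x^β = x_1^{β_1} ⋯ x_n^{β_n}`. -/
def mono (n : ℕ) (β : Fin n → ℕ) : MvPolynomial (Fin n) ℤ := monomial (expOf n β) 1

/-- The coefficient `[x^β] f`. -/
def coeffOf (n : ℕ) (β : Fin n → ℕ) (f : MvPolynomial (Fin n) ℤ) : ℤ := coeff (expOf n β) f

/-- The isobaric divided difference (Demazure) operator
`π_i(f) = (x_i f − x_{i+1} s_i f)/(x_i − x_{i+1})` (1-indexed `i`), defined as the unique
polynomial `g` with `(x_i − x_{i+1})·g = x_i f − x_{i+1} s_i f`; such a `g` always exists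
and is unique since `ℤ[x_1,…,x_n]` is a domain. -/
def dem (n : ℕ) (i : ℕ) (f : MvPolynomial (Fin n) ℤ) : MvPolynomial (Fin n) ℤ :=
  if h : 0 < i ∧ i < n then
    if hg : ∃ g, (X (⟨i - 1, by omega⟩ : Fin n) - X (⟨i, h.2⟩ : Fin n)) * g =
        X (⟨i - 1, by omega⟩ : Fin n) * f -
          X (⟨i, h.2⟩ : Fin n) *
            rename (⇑(Equiv.swap (⟨i - 1, by omega⟩ : Fin n) (⟨i, h.2⟩ : Fin n))) f then
      hg.choose
    else 0
  else f

/-- `π_{i_1} π_{i_2} ⋯ π_{i_ℓ} (f)` for a word `L = [i_1, …, i_ℓ]`. -/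
def demWord (n : ℕ) (L : List ℕ) (f : MvPolynomial (Fin n) ℤ) : MvPolynomial (Fin n) ℤ :=
  L.foldr (dem n) f

/-- Entry accessor for a composition, 0-indexed position, default `0` out of range. -/
def ent (n : ℕ) (α : Fin n → ℕ) (p : ℕ) : ℕ := if h : p < n then α ⟨p, h⟩ else 0

/-- Exchange the entries of `α` in (0-indexed) positions `p` and `p+1`. -/
def swapAt (n : ℕ) (p : ℕ) (α : Fin n → ℕ) : Fin n → ℕ := fun m =>
  if (m : ℕ) = p then ent n α (p + 1) else if (m : ℕ) = p + 1 then ent n α p else α m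

/-- Auxiliary fuelled recursion computing the key polynomial `κ_α`:
if `α` is weakly decreasing, `κ_α = x^α`; otherwise, choosing an ascent `α_p < α_{p+1}`
(0-indexed `p`), `κ_α = π_{p+1}(κ_{α̂})` where `α̂` swaps the two entries.  The fuel
`n*n` in `keyPoly` strictly exceeds the number of co-inversions, which drops by one at
each step, so the recursion always terminates at a weakly decreasing composition. -/
def keyAux (n : ℕ) : ℕ → (Fin n → ℕ) → MvPolynomial (Fin n) ℤ
  | 0, α => mono n α
  | k + 1, α =>
    if h : ∃ p : Fin n, ent n α p.1 < ent n α (p.1 + 1) then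
      dem n (h.choose.1 + 1) (keyAux n k (swapAt n h.choose.1 α))
    else mono n α

/-- The key polynomial `κ_α`. -/
def keyPoly (n : ℕ) (α : Fin n → ℕ) : MvPolynomial (Fin n) ℤ := keyAux n (n * n) α

/-- `wλ`, the composition `(λ_{w⁻¹(1)}, …, λ_{w⁻¹(n)})`. -/
def pact (n : ℕ) (w : Equiv.Perm (Fin n)) (lam : Fin n → ℕ) : Fin n → ℕ :=
  fun i => lam (w⁻¹ i)

/-- `lam` is a partition (weakly decreasing vector) with at most `n` parts. -/
def IsPartition (n : ℕ) (lam : Fin n → ℕ) : Prop := ∀ i j : Fin n, i ≤ j → lam j ≤ lam i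

/-- Box `(c, r)` (column, row; both 1-indexed) belongs to the skyline diagram `D(α)`. -/
def InDiag (n : ℕ) (α : Fin n → ℕ) (c r : ℕ) : Prop :=
  1 ≤ c ∧ c ≤ n ∧ 1 ≤ r ∧ r ≤ ent n α (c - 1)

/-- `F` (value of box (column, row)) is a filling of `D(α)` that is flagged (labels in
column `c` are in `{1, …, c}`) and row distinct. -/
def IsTab (n : ℕ) (α : Fin n → ℕ) (F : ℕ → ℕ → ℕ) : Prop :=
  (∀ c r, InDiag n α c r → 1 ≤ F c r ∧ F c r ≤ c) ∧
  ∀ c c' r, InDiag n α c r → InDiag n α c' r → c ≠ c' → F c r ≠ F c' r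

/-- The weight of a filling: `wt(F)_i` = number of occurrences of the label `i`
(1-indexed; `Fin` position `i` records the label `i+1`). -/
def wt (n : ℕ) (α : Fin n → ℕ) (F : ℕ → ℕ → ℕ) : Fin n → ℕ := fun i =>
  ((Finset.Icc 1 n ×ˢ Finset.Icc 1 (Finset.univ.sup α)).filter fun p =>
    InDiag n α p.1 p.2 ∧ F p.1 p.2 = i.1 + 1).card

/-- `leftmin_α(i) = min{α_j : j ≤ i}`. -/
def leftmin (n : ℕ) (α : Fin n → ℕ) (i : Fin n) : ℕ := sInf (α '' {j | j ≤ i})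

/-- `rightmax_α(i) = max{α_j : j ≥ i}`. -/
def rightmax (n : ℕ) (α : Fin n → ℕ) (i : Fin n) : ℕ :=
  Finset.sup (Finset.univ.filter fun j => i ≤ j) α

/-- `d` records `0 = d_0 < d_1 < ⋯ < d_k < d_{k+1} = n`. -/
def BlockData (n k : ℕ) (d : Fin (k + 2) → ℕ) : Prop :=
  d 0 = 0 ∧ d (Fin.last (k + 1)) = n ∧ StrictMono d

/-- `D = {d_1, …, d_k}` as a set of natural numbers. -/
def Dset (k : ℕ) (d : Fin (k + 2) → ℕ) : Set ℕ :=
  {m | ∃ t : Fin (k + 2), t ≠ 0 ∧ t ≠ Fin.last (k + 1) ∧ d t = m}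

/-- `I = [n−1] ∖ D`. -/
def Iset (n k : ℕ) (d : Fin (k + 2) → ℕ) : Set ℕ :=
  {m | 1 ≤ m ∧ m ≤ n - 1 ∧ m ∉ Dset k d}

/-- Positions `i, j` (of `Fin n`, 0-indexed; 1-indexed letters `i+1, j+1`) lie in the same
block: some `t` has `d_t < i+1, j+1 ≤ d_{t+1}`. -/
def SameBlock (n k : ℕ) (d : Fin (k + 2) → ℕ) (i j : Fin n) : Prop :=
  ∃ t : Fin (k + 1), d t.castSucc ≤ i.1 ∧ i.1 < d t.succ ∧ d t.castSucc ≤ j.1 ∧ j.1 < d t.succ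

/-- The variables `X_t = {x_{d_t + 1}, …, x_{d_{t+1}}}` of the `t`-th block. -/
def blockVars (n k : ℕ) (d : Fin (k + 2) → ℕ) (t : Fin (k + 1)) : Finset (Fin n) :=
  Finset.univ.filter fun p => d t.castSucc ≤ p.1 ∧ p.1 < d t.succ

/-- Complete homogeneous symmetric polynomial of degree `m` in the variables `S`. -/
def hPoly (n : ℕ) (S : Finset (Fin n)) (m : ℕ) : MvPolynomial (Fin n) ℤ :=
  ∑ f ∈ S.sym m, ((f : Multiset (Fin n)).map X).prod

/-- `h_z` for `z : ℤ`, with `h_z = 0` for `z < 0`. -/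
def hZ (n : ℕ) (S : Finset (Fin n)) (z : ℤ) : MvPolynomial (Fin n) ℤ :=
  if 0 ≤ z then hPoly n S z.toNat else 0

/-- The Schur polynomial `s_lam` in the variable set `S`, for a partition `lam`
(1-indexed parts, at most `t` of them), via the Jacobi–Trudi determinant
`det(h_{lam_i − i + j})_{1 ≤ i,j ≤ t}`. -/
def schurP (n : ℕ) (S : Finset (Fin n)) (t : ℕ) (lam : ℕ → ℕ) : MvPolynomial (Fin n) ℤ :=
  (Matrix.of fun i j : Fin t =>
    hZ n S ((lam (i.1 + 1) : ℤ) - (i.1 + 1) + (j.1 + 1))).det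

/-- `γ ∈ Par_D`: a `(k+1)`-tuple of partitions, the `t`-th having at most
`d_{t+1} − d_t` nonzero parts (1-indexed parts; the unused index `0` is normalized to `0`). -/
def ParD (k : ℕ) (d : Fin (k + 2) → ℕ) (γ : Fin (k + 1) → ℕ → ℕ) : Prop :=
  ∀ t : Fin (k + 1), γ t 0 = 0 ∧ (∀ a b : ℕ, 1 ≤ a → a ≤ b → γ t b ≤ γ t a) ∧
    ∀ m : ℕ, d t.succ - d t.castSucc < m → γ t m = 0

/-- The `D`-Schur polynomial `s_{γ^1,…,γ^{k+1}} = ∏_t s_{γ^t}(X_t)`. -/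
def dSchur (n k : ℕ) (d : Fin (k + 2) → ℕ) (γ : Fin (k + 1) → ℕ → ℕ) :
    MvPolynomial (Fin n) ℤ :=
  ∏ t : Fin (k + 1), schurP n (blockVars n k d t) (d t.succ - d t.castSucc) (γ t)

/-- Truncation of an integer vector to a natural-number vector. -/
def toNatV (n : ℕ) (β : Fin n → ℤ) : Fin n → ℕ := fun i => (β i).toNat

/-- `j − i` as an integer. -/
def gapZ (n : ℕ) (i j : Fin n) : ℤ := (j.1 : ℤ) - (i.1 : ℤ)

/-- The move `t_{ij}`: replace `β_i` by `β_j − (j−i)` and `β_j` by `β_i + (j−i)`. -/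
def tmv (n : ℕ) (i j : Fin n) (β : Fin n → ℤ) : Fin n → ℤ := fun m =>
  if m = i then β j - gapZ n i j else if m = j then β i + gapZ n i j else β m

/-- The rank `θ(β) = #{(a,b) : a < b in the same block and β_a < β_b − (b−a)}`. -/
def theta (n k : ℕ) (d : Fin (k + 2) → ℕ) (β : Fin n → ℤ) : ℕ :=
  (Finset.univ.filter fun p : Fin n × Fin n =>
    p.1 < p.2 ∧ SameBlock n k d p.1 p.2 ∧ β p.1 < β p.2 - gapZ n p.1 p.2).card

/-- One step up in the Bruhat-type order: `β ⋖ t_{ij} β` whenever `i < j` are in the same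
block and `β_i > β_j − (j−i)`. -/
def stepUp (n k : ℕ) (d : Fin (k + 2) → ℕ) (β β' : Fin n → ℤ) : Prop :=
  ∃ i j : Fin n, i < j ∧ SameBlock n k d i j ∧ β j - gapZ n i j < β i ∧ β' = tmv n i j β

/-- The order on compositions: transitive (reflexive) closure of `stepUp`. -/
def leB (n k : ℕ) (d : Fin (k + 2) → ℕ) : (Fin n → ℤ) → (Fin n → ℤ) → Prop :=
  Relation.ReflTransGen (stepUp n k d)

/-- Membership in the poset `P_{α,γ}` (for `α = cλ`): `β` is a weak composition with
`[x^β] κ_α ≠ 0` and `π_{w_0(I)}(x^β) = ± s_γ`. -/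
def memP (n k : ℕ) (d : Fin (k + 2) → ℕ) (w0I : Equiv.Perm (Fin n)) (α : Fin n → ℕ)
    (γ : Fin (k + 1) → ℕ → ℕ) (β : Fin n → ℤ) : Prop :=
  (∀ i, 0 ≤ β i) ∧ coeffOf n (toNatV n β) (keyPoly n α) ≠ 0 ∧
  ∃ L, IsRedWord n L w0I ∧
    (demWord n L (mono n (toNatV n β)) = dSchur n k d γ ∨
     demWord n L (mono n (toNatV n β)) = -dSchur n k d γ)

/-- The pair `i < j` is interweaved for `α`: `α_m ≥ α_{m+1}` for `i ≤ m < j`,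
`leftmin_α(i) < α_i` and `rightmax_α(j) > α_j`. -/
def Interweaved (n : ℕ) (α : Fin n → ℕ) (i j : Fin n) : Prop :=
  i < j ∧ (∀ p : Fin n, i ≤ p → p < j → ent n α (p.1 + 1) ≤ α p) ∧
  leftmin n α i < α i ∧ α j < rightmax n α j

/-- `center_α(i,j) = max{m : i ≤ m ≤ j and α_m ≥ rightmax_α(j)}` (as a 0-indexed position). -/
def center (n : ℕ) (α : Fin n → ℕ) (i j : Fin n) : ℕ :=
  Finset.sup (Finset.univ.filter fun p : Fin n => i ≤ p ∧ p ≤ j ∧ rightmax n α j ≤ α p)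
    fun p => p.1

/-- Partial sum `β_1 + ⋯ + β_{m+1}` (0-indexed positions `≤ m`) of an integer vector. -/
def psumZ (n : ℕ) (β : Fin n → ℤ) (m : ℕ) : ℤ :=
  ∑ p ∈ Finset.univ.filter (fun p : Fin n => p.1 ≤ m), β p

/-- Partial sum of a composition, as an integer. -/
def psumN (n : ℕ) (α : Fin n → ℕ) (m : ℕ) : ℤ :=
  ∑ p ∈ Finset.univ.filter (fun p : Fin n => p.1 ≤ m), (α p : ℤ)

/-- Composition pattern containment. -/
def ContainsPat (n : ℕ) {m : ℕ} (α : Fin n → ℕ) (pat : Fin m → ℕ) : Prop :=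
  ∃ g : Fin m → Fin n, StrictMono g ∧
    (∀ s t : Fin m, pat s ≤ pat t ↔ α (g s) ≤ α (g t)) ∧
    ∀ s t : Fin m, |(pat s : ℤ) - (pat t : ℤ)| ≤ |(α (g s) : ℤ) - (α (g t) : ℤ)|

end

end LSS
namespace LSS

open MvPolynomial

/-- Exponent `γ` with the entries at `a`, `b` replaced by `r`, `s`. -/
noncomputable def updTwo {n : ℕ} (γ : Fin n →₀ ℕ) (a b : Fin n) (r s : ℕ) : Fin n →₀ ℕ :=
  Finsupp.equivFunOnFinite.symm (fun j => if j = a then r else if j = b then s else γ j)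

lemma updTwo_apply {n : ℕ} (γ : Fin n →₀ ℕ) (a b : Fin n) (r s : ℕ) (j : Fin n) :
    updTwo γ a b r s j = if j = a then r else if j = b then s else γ j := rfl

lemma X_mul_updTwo_left {n : ℕ} (γ : Fin n →₀ ℕ) (a b : Fin n) (hab : a ≠ b) (r s : ℕ) :
    (X a : MvPolynomial (Fin n) ℤ) * monomial (updTwo γ a b r s) 1
      = monomial (updTwo γ a b (r + 1) s) 1 := by
  rw [X, monomial_mul, one_mul]
  refine congrArg (fun e => (monomial e) (1 : ℤ)) ?_
  ext j
  simp only [Finsupp.add_apply, updTwo_apply, Finsupp.single_apply]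
  by_cases h1 : j = a
  · subst h1; simp [hab, hab.symm, add_comm]
  · by_cases h2 : j = b
    · subst h2; simp [hab, hab.symm, add_comm]
    · simp [h1, h2, Ne.symm h1, Ne.symm h2]

lemma X_mul_updTwo_right {n : ℕ} (γ : Fin n →₀ ℕ) (a b : Fin n) (hab : a ≠ b) (r s : ℕ) :
    (X b : MvPolynomial (Fin n) ℤ) * monomial (updTwo γ a b r s) 1
      = monomial (updTwo γ a b r (s + 1)) 1 := by
  rw [X, monomial_mul, one_mul]
  refine congrArg (fun e => (monomial e) (1 : ℤ)) ?_
  ext j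
  simp only [Finsupp.add_apply, updTwo_apply, Finsupp.single_apply]
  by_cases h1 : j = a
  · subst h1; simp [hab, hab.symm, add_comm]
  · by_cases h2 : j = b
    · subst h2; simp [hab, hab.symm, add_comm]
    · simp [h1, h2, Ne.symm h1, Ne.symm h2]

/-- `δ` lies on the segment between `γ` and its swap at `a`, `b`. -/
def InStr {n : ℕ} (a b : Fin n) (γ δ : Fin n →₀ ℕ) : Prop :=
  (∀ j, j ≠ a → j ≠ b → δ j = γ j) ∧ δ a + δ b = γ a + γ b ∧
    min (γ a) (γ b) ≤ δ a ∧ min (γ a) (γ b) ≤ δ b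

lemma exists_sum_updTwo {n : ℕ} (γ : Fin n →₀ ℕ) (a b : Fin n) (hab : a ≠ b) (r s d : ℕ)
    (hd : d ≤ s + 1) (P : (Fin n →₀ ℕ) → Prop)
    (hP : ∀ j < d, P (updTwo γ a b (r + j) (s - j))) :
    ∃ g : MvPolynomial (Fin n) ℤ, (X a - X b) * g =
      monomial (updTwo γ a b (r + d) (s + 1 - d)) 1 - monomial (updTwo γ a b r (s + 1)) 1 ∧
      ∀ δ ∈ g.support, P δ := by
  refine ⟨∑ j ∈ Finset.range d, monomial (updTwo γ a b (r + j) (s - j)) 1, ?_, ?_⟩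
  · rw [Finset.mul_sum]
    have := Finset.sum_range_sub
      (fun j => (monomial (updTwo γ a b (r + j) (s + 1 - j)) 1 : MvPolynomial (Fin n) ℤ)) d
    simp only [add_zero, Nat.sub_zero] at this
    rw [← this]
    apply Finset.sum_congr rfl
    intro j hj
    have hj := Finset.mem_range.mp hj
    rw [sub_mul, X_mul_updTwo_left _ _ _ hab, X_mul_updTwo_right _ _ _ hab]
    have h1 : s - j + 1 = s + 1 - j := by omega
    have h2 : s + 1 - (j + 1) = s - j := by omega
    rw [h1, h2, add_assoc]
  · intro δ hδ
    obtain ⟨j, hj, hj'⟩ := Finset.mem_biUnion.mp (support_sum hδ)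
    have := Finset.mem_singleton.mp (support_monomial_subset hj')
    rw [this]
    exact hP j (Finset.mem_range.mp hj)

lemma dem_monomial {n : ℕ} (a b : Fin n) (hab : a ≠ b) (γ : Fin n →₀ ℕ) :
    ∃ g : MvPolynomial (Fin n) ℤ, (X a - X b) * g =
      X a * monomial γ 1 - X b * rename (Equiv.swap a b) (monomial γ 1) ∧
      ∀ δ ∈ g.support, InStr a b γ δ := by
  have e1 : γ = updTwo γ a b (γ a) (γ b) := by
    ext j; rw [updTwo_apply]; split_ifs with h1 h2
    · rw [h1]
    · rw [h2]
    · rfl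
  have e2 : Finsupp.mapDomain (Equiv.swap a b) γ = updTwo γ a b (γ b) (γ a) := by
    ext j
    rw [Finsupp.mapDomain_equiv_apply, updTwo_apply, Equiv.symm_swap, Equiv.swap_apply_def]
    split_ifs <;> rfl
  have hstr : ∀ r s, r + s = γ a + γ b → min (γ a) (γ b) ≤ r → min (γ a) (γ b) ≤ s →
      InStr a b γ (updTwo γ a b r s) := by
    intro r s h1 h2 h3
    have ea : updTwo γ a b r s a = r := by simp [updTwo_apply]
    have eb : updTwo γ a b r s b = s := by simp [updTwo_apply, hab.symm]
    refine ⟨fun j h4 h5 => ?_, ?_, ?_, ?_⟩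
    · rw [updTwo_apply, if_neg h4, if_neg h5]
    · rw [ea, eb, h1]
    · rwa [ea]
    · rwa [eb]
  have e3 : (X a * monomial γ 1 - X b * rename (Equiv.swap a b) (monomial γ 1)
      : MvPolynomial (Fin n) ℤ) = monomial (updTwo γ a b (γ a + 1) (γ b)) 1
        - monomial (updTwo γ a b (γ b) (γ a + 1)) 1 := by
    rw [rename_monomial, e2, X_mul_updTwo_right _ _ _ hab, ← X_mul_updTwo_left _ _ _ hab, ← e1]
  rw [e3]
  rcases le_or_gt (γ b) (γ a) with h | h
  · obtain ⟨g, hg, hg'⟩ := exists_sum_updTwo γ a b hab (γ b) (γ a) (γ a + 1 - γ b) (by omega)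
      (InStr a b γ) (fun j hj => hstr _ _ (by omega) (by omega) (by omega))
    refine ⟨g, ?_, hg'⟩
    rw [hg]
    congr 4 <;> omega
  · obtain ⟨g, hg, hg'⟩ := exists_sum_updTwo γ a b hab (γ a + 1) (γ b - 1) (γ b - γ a - 1)
      (by omega) (InStr a b γ) (fun j hj => hstr _ _ (by omega) (by omega) (by omega))
    refine ⟨-g, ?_, by rwa [support_neg]⟩
    rw [mul_neg, hg, neg_sub]
    congr 4 <;> omega

lemma dem_exists {n : ℕ} (a b : Fin n) (hab : a ≠ b) (f : MvPolynomial (Fin n) ℤ)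
    (P : (Fin n →₀ ℕ) → Prop) (hP : ∀ γ ∈ f.support, ∀ δ, InStr a b γ δ → P δ) :
    ∃ g : MvPolynomial (Fin n) ℤ, (X a - X b) * g =
      X a * f - X b * rename (Equiv.swap a b) f ∧ ∀ δ ∈ g.support, P δ := by
  choose G hG hG' using dem_monomial a b hab
  refine ⟨∑ γ ∈ f.support, C (coeff γ f) * G γ, ?_, ?_⟩
  · have hf : f = ∑ γ ∈ f.support, C (coeff γ f) * monomial γ 1 := by
      conv_lhs => rw [f.as_sum]
      exact Finset.sum_congr rfl fun γ _ => by rw [C_mul_monomial, mul_one]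
    conv_rhs => rw [hf]
    rw [map_sum, Finset.mul_sum, Finset.mul_sum, Finset.mul_sum, ← Finset.sum_sub_distrib]
    apply Finset.sum_congr rfl
    intro γ _
    rw [map_mul, rename_C]
    linear_combination (C (coeff γ f)) * hG γ
  · intro δ hδ
    obtain ⟨γ, hγ, hγ'⟩ := Finset.mem_biUnion.mp (support_sum hδ)
    refine hP γ hγ δ (hG' γ δ ?_)
    rw [mem_support_iff, coeff_C_mul] at hγ'
    rw [mem_support_iff]
    exact right_ne_zero_of_mul hγ'

lemma dem_support {n : ℕ} (p : ℕ) (hp : p + 1 < n) (f : MvPolynomial (Fin n) ℤ)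
    (P : (Fin n →₀ ℕ) → Prop)
    (hP : ∀ γ ∈ f.support, ∀ δ, InStr ⟨p, by omega⟩ ⟨p + 1, hp⟩ γ δ → P δ) :
    ∀ δ ∈ (dem n (p + 1) f).support, P δ := by
  have hab : (⟨p, by omega⟩ : Fin n) ≠ ⟨p + 1, hp⟩ := by simp
  obtain ⟨g, hg, hg'⟩ := dem_exists _ _ hab f P hP
  have h : 0 < p + 1 ∧ p + 1 < n := ⟨by omega, hp⟩
  have hex : ∃ g, (X (⟨p + 1 - 1, by omega⟩ : Fin n) - X (⟨p + 1, h.2⟩ : Fin n)) * g =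
        X (⟨p + 1 - 1, by omega⟩ : Fin n) * f -
          X (⟨p + 1, h.2⟩ : Fin n) *
            rename (⇑(Equiv.swap (⟨p + 1 - 1, by omega⟩ : Fin n) (⟨p + 1, h.2⟩ : Fin n))) f :=
    ⟨g, hg⟩
  have hd : dem n (p + 1) f = g := by
    unfold dem
    rw [dif_pos h, dif_pos hex]
    have h1 := hex.choose_spec
    have h2 := h1.trans hg.symm
    refine mul_left_cancel₀ ?_ h2
    rw [sub_ne_zero]
    exact fun h => hab (X_injective h)
  rw [hd]
  exact hg'

/-- Prefix sums. -/
def pre {n : ℕ} (t : ℕ) (h : Fin n → ℕ) : ℕ :=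
  ∑ i ∈ Finset.univ.filter (fun i : Fin n => i.1 < t), h i

lemma pre_succ {n : ℕ} (t : ℕ) (ht : t < n) (h : Fin n → ℕ) :
    pre (t + 1) h = pre t h + h ⟨t, ht⟩ := by
  unfold pre
  have : Finset.univ.filter (fun i : Fin n => i.1 < t + 1)
      = insert ⟨t, ht⟩ (Finset.univ.filter (fun i : Fin n => i.1 < t)) := by
    ext i; simp [Fin.ext_iff]; omega
  rw [this, Finset.sum_insert (by simp), add_comm]

lemma pre_swap_low {n : ℕ} (p : ℕ) (hp : p + 1 < n) (t : ℕ) (ht : t ≤ p) (h : Fin n → ℕ) :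
    pre t (h ∘ Equiv.swap (⟨p, by omega⟩ : Fin n) ⟨p + 1, hp⟩) = pre t h := by
  unfold pre
  apply Finset.sum_congr rfl
  intro i hi
  have hi := (Finset.mem_filter.mp hi).2
  rw [Function.comp_apply, Equiv.swap_apply_of_ne_of_ne] <;> simp [Fin.ext_iff] <;> omega

lemma pre_swap_high {n : ℕ} (p : ℕ) (hp : p + 1 < n) (t : ℕ) (ht : p + 2 ≤ t) (h : Fin n → ℕ) :
    pre t (h ∘ Equiv.swap (⟨p, by omega⟩ : Fin n) ⟨p + 1, hp⟩) = pre t h := by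
  unfold pre
  apply Finset.sum_equiv (Equiv.swap (⟨p, by omega⟩ : Fin n) ⟨p + 1, hp⟩)
  · intro i
    simp only [Finset.mem_filter, Finset.mem_univ, true_and]
    rw [Equiv.swap_apply_def]
    split_ifs <;> simp_all <;> omega
  · intro i _; rfl

lemma pre_dom {n : ℕ} (p : ℕ) (hp : p + 1 < n) (F h : Fin n → ℕ)
    (hF : ∀ i, F i ≤ 1) (h1 : ∀ i, h i ≤ 1) (hab : h ⟨p + 1, hp⟩ ≤ h ⟨p, by omega⟩)
    (hdom : ∀ t, pre t h ≤ pre t F) (t : ℕ) :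
    pre t (h ∘ Equiv.swap (⟨p, by omega⟩ : Fin n) ⟨p + 1, hp⟩) ≤ pre t F ∧
    pre t (h ∘ Equiv.swap (⟨p, by omega⟩ : Fin n) ⟨p + 1, hp⟩) ≤
      pre t (F ∘ Equiv.swap (⟨p, by omega⟩ : Fin n) ⟨p + 1, hp⟩) := by
  rcases lt_trichotomy t (p + 1) with ht | ht | ht
  · rw [pre_swap_low p hp t (by omega), pre_swap_low p hp t (by omega)]
    exact ⟨hdom t, hdom t⟩
  · subst ht
    have a0 := hdom p
    have a1 := hdom (p + 1)
    have a2 := hdom (p + 1 + 1)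
    rw [pre_succ (p + 1) hp, pre_succ (p + 1) hp] at a2
    rw [pre_succ p (by omega), pre_succ p (by omega)] at a1 a2
    rw [pre_succ p (by omega), pre_succ p (by omega), pre_succ p (by omega),
      pre_swap_low p hp p le_rfl, pre_swap_low p hp p le_rfl]
    simp only [Function.comp_apply, Equiv.swap_apply_left]
    have b0 := hF ⟨p, by omega⟩
    have b1 := hF ⟨p + 1, hp⟩
    have b2 := h1 ⟨p, by omega⟩
    omega
  · rw [pre_swap_high p hp t (by omega), pre_swap_high p hp t (by omega)]
    exact ⟨hdom t, hdom t⟩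

/-- `k`-th layer of `α`. -/
def lay {n : ℕ} (α : Fin n → ℕ) (k : ℕ) : Fin n → ℕ := fun i => if k < α i then 1 else 0

/-- `β` splits in 0/1 layers dominating those of `α`. -/
def Good {n : ℕ} (α β : Fin n → ℕ) : Prop :=
  ∃ (N : ℕ) (F : ℕ → Fin n → ℕ), (∀ k i, F k i ≤ 1) ∧ (∀ i, β i = ∑ k ∈ Finset.range N, F k i) ∧
    (∀ i, α i ≤ N) ∧ ∀ k t, pre t (lay α k) ≤ pre t (F k)

lemma sum_lay {n : ℕ} (α : Fin n → ℕ) (N : ℕ) (i : Fin n) (h : α i ≤ N) :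
    α i = ∑ k ∈ Finset.range N, lay α k i := by
  unfold lay
  rw [← Finset.sum_filter, Finset.sum_const, smul_eq_mul, mul_one]
  have : (Finset.range N).filter (fun k => k < α i) = Finset.range (α i) := by
    ext k; simp; omega
  rw [this, Finset.card_range]

lemma good_self {n : ℕ} (α : Fin n → ℕ) : Good α α := by
  have hN : ∀ i, α i ≤ Finset.univ.sup α := fun i => Finset.le_sup (Finset.mem_univ i)
  refine ⟨Finset.univ.sup α, lay α, ?_, fun i => sum_lay α _ i (hN i), hN, fun _ _ => le_rfl⟩
  intro k i; unfold lay; split_ifs <;> simp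

lemma good_pre {n : ℕ} (α β : Fin n → ℕ) (h : Good α β) (t : ℕ) : pre t α ≤ pre t β := by
  obtain ⟨N, F, -, h2, h3, h4⟩ := h
  have e1 : pre t α = ∑ k ∈ Finset.range N, pre t (lay α k) := by
    unfold pre
    rw [Finset.sum_comm]
    exact Finset.sum_congr rfl fun i _ => sum_lay α N i (h3 i)
  have e2 : pre t β = ∑ k ∈ Finset.range N, pre t (F k) := by
    unfold pre
    rw [Finset.sum_comm]
    exact Finset.sum_congr rfl fun i _ => h2 i
  rw [e1, e2]
  exact Finset.sum_le_sum fun k _ => h4 k t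

/-- Choosing layers to flip. -/
lemma flip_layers {n : ℕ} (x y : Fin n) (hxy : x ≠ y) (N : ℕ) (F : ℕ → Fin n → ℕ)
    (hF : ∀ k i, F k i ≤ 1) (γ δ : Fin n → ℕ) (hγ : ∀ i, γ i = ∑ k ∈ Finset.range N, F k i)
    (ho : ∀ j, j ≠ x → j ≠ y → δ j = γ j) (hs : δ x + δ y = γ x + γ y)
    (hle : δ x ≤ γ x) (hm : min (γ x) (γ y) ≤ δ x) :
    ∃ S : Finset ℕ, ∀ i, δ i =
      ∑ k ∈ Finset.range N, (if k ∈ S then F k ∘ Equiv.swap x y else F k) i := by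
  set U := (Finset.range N).filter (fun k => F k x = 1 ∧ F k y = 0) with hU
  have hcard : γ x ≤ γ y + U.card := by
    rw [hγ, hγ, hU, Finset.card_filter, ← Finset.sum_add_distrib]
    apply Finset.sum_le_sum
    intro k _
    have := hF k x
    have := hF k y
    split_ifs <;> omega
  obtain ⟨S, hSU, hS⟩ := Finset.exists_subset_card_eq (s := U) (n := γ x - δ x) (by omega)
  have hcount : (∑ k ∈ Finset.range N, if k ∈ S then 1 else 0) = γ x - δ x := by
    rw [← hS, ← Finset.card_filter]
    congr 1
    ext k
    simp only [Finset.mem_filter]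
    refine ⟨fun h => h.2, fun h => ⟨?_, h⟩⟩
    exact (Finset.mem_filter.mp (hSU h)).1
  have hSm : ∀ k ∈ S, F k x = 1 ∧ F k y = 0 := fun k h => (Finset.mem_filter.mp (hSU h)).2
  have hx : ∑ k ∈ Finset.range N, (if k ∈ S then F k ∘ Equiv.swap x y else F k) x
      + (γ x - δ x) = γ x := by
    rw [← hcount, ← Finset.sum_add_distrib, hγ x]
    apply Finset.sum_congr rfl
    intro k _
    by_cases h : k ∈ S
    · have := hSm k h
      simp [h, this]
    · simp [h]
  have hy : ∑ k ∈ Finset.range N, (if k ∈ S then F k ∘ Equiv.swap x y else F k) y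
      = γ y + (γ x - δ x) := by
    rw [← hcount, hγ y, ← Finset.sum_add_distrib]
    apply Finset.sum_congr rfl
    intro k _
    by_cases h : k ∈ S
    · have := hSm k h
      simp [h, this]
    · simp [h]
  refine ⟨S, fun i => ?_⟩
  by_cases h1 : i = x
  · subst h1; omega
  by_cases h2 : i = y
  · subst h2; omega
  rw [ho i h1 h2, hγ]
  apply Finset.sum_congr rfl
  intro k _
  split_ifs
  · rw [Function.comp_apply, Equiv.swap_apply_of_ne_of_ne h1 h2]
  · rfl

lemma good_step {n : ℕ} (p : ℕ) (hp : p + 1 < n) (α : Fin n → ℕ)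
    (hα : α ⟨p + 1, hp⟩ ≤ α ⟨p, by omega⟩) (γ δ : Fin n →₀ ℕ) (hg : Good α γ)
    (hs : InStr ⟨p, by omega⟩ ⟨p + 1, hp⟩ γ δ) :
    Good (α ∘ Equiv.swap (⟨p, by omega⟩ : Fin n) ⟨p + 1, hp⟩) δ := by
  obtain ⟨N, F, h1, h2, h3, h4⟩ := hg
  obtain ⟨s1, s2, s3, s4⟩ := hs
  have hab : (⟨p, by omega⟩ : Fin n) ≠ ⟨p + 1, hp⟩ := by simp
  obtain ⟨S, hS⟩ : ∃ S : Finset ℕ, ∀ i, δ i = ∑ k ∈ Finset.range N,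
      (if k ∈ S then F k ∘ Equiv.swap (⟨p, by omega⟩ : Fin n) ⟨p + 1, hp⟩ else F k) i := by
    rcases le_total (δ ⟨p, by omega⟩) (γ ⟨p, by omega⟩) with h | h
    · exact flip_layers _ _ hab N F h1 γ δ h2 s1 s2 h s3
    · rw [Equiv.swap_comm]
      exact flip_layers _ _ hab.symm N F h1 γ δ h2 (fun j a b => s1 j b a) (by omega) (by omega)
        (by rwa [min_comm])
  refine ⟨N, _, ?_, hS, fun i => h3 _, ?_⟩
  · intro k i
    split_ifs
    · exact h1 k _
    · exact h1 k i
  · intro k t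
    have := pre_dom p hp (F k) (lay α k) (h1 k)
      (by intro i; unfold lay; split_ifs <;> simp)
      (by unfold lay; split_ifs <;> omega) (h4 k) t
    have e : lay (α ∘ Equiv.swap (⟨p, by omega⟩ : Fin n) ⟨p + 1, hp⟩) k
      = lay α k ∘ Equiv.swap (⟨p, by omega⟩ : Fin n) ⟨p + 1, hp⟩ := rfl
    rw [e]
    split_ifs
    · exact this.2
    · exact this.1

lemma swapAt_eq {n : ℕ} (p : ℕ) (hp : p + 1 < n) (α : Fin n → ℕ) :
    swapAt n p α = α ∘ Equiv.swap (⟨p, by omega⟩ : Fin n) ⟨p + 1, hp⟩ := by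
  have hp' : p < n := by omega
  ext m
  simp only [swapAt, ent, hp, hp', dif_pos, Function.comp_apply, Equiv.swap_apply_def, Fin.ext_iff]
  split_ifs <;> rfl

lemma mono_good {n : ℕ} (α : Fin n → ℕ) : ∀ δ ∈ (mono n α).support, Good α δ := by
  intro δ hδ
  have := Finset.mem_singleton.mp (support_monomial_subset hδ)
  rw [this]
  exact good_self α

lemma key_good {n : ℕ} (k : ℕ) : ∀ α : Fin n → ℕ, ∀ δ ∈ (keyAux n k α).support, Good α δ := by
  induction k with
  | zero => exact mono_good
  | succ k ih =>
    intro α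
    unfold keyAux
    split_ifs with h
    · have hc := h.choose_spec
      set q := h.choose
      have hp : q.1 + 1 < n := by
        by_contra hh
        rw [ent, ent, dif_neg hh] at hc
        omega
      apply dem_support q.1 hp
      intro γ hγ δ hs
      have hg := ih _ γ hγ
      rw [swapAt_eq q.1 hp] at hg
      rw [ent, ent, dif_pos hp, dif_pos q.2] at hc
      have := good_step q.1 hp _ (by simpa using hc.le) γ δ hg hs
      have e : (α ∘ Equiv.swap (⟨q.1, by omega⟩ : Fin n) ⟨q.1 + 1, hp⟩) ∘
        Equiv.swap (⟨q.1, by omega⟩ : Fin n) ⟨q.1 + 1, hp⟩ = α := by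
        ext i; simp
      rwa [e] at this
    · exact mono_good α

/-- Corollary 4.8: if `[x^β] κ_α > 0` then `β` dominates `α`. -/
theorem stmt9 (n : ℕ) (α β : Fin n → ℕ) (hβ : 0 < coeffOf n β (keyPoly n α)) :
    ∀ t : Fin n,
      ∑ p ∈ Finset.univ.filter (fun p : Fin n => p ≤ t), α p ≤
        ∑ p ∈ Finset.univ.filter (fun p : Fin n => p ≤ t), β p := by
  intro t
  have h := key_good (n * n) α (expOf n β) (MvPolynomial.mem_support_iff.mpr hβ.ne')
  have h2 := good_pre α β h (t.1 + 1)
  have e : Finset.univ.filter (fun p : Fin n => p ≤ t)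
      = Finset.univ.filter (fun p : Fin n => p.1 < t.1 + 1) := by
    ext i
    simp only [Finset.mem_filter, Finset.mem_univ, true_and, Fin.le_def]
    omega
  rw [e]
  unfold pre at h2
  convert h2

end LSS
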